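/- arXiv:0808.3881 — 3 statements merged into one kernel-verified Lean document; each statement's English description precedes it below -/
import Mathlib

section
/- Let A be a proper assignment set for a closed walk W in the brickwall 𝓑, and let 𝒞 be the set of elementary cycles of (W, A). Then t(W) = Σ_{C ∈ 𝒞} (t(C) − 1) + 1. -/
open scoped Classical

namespace Hex

/-- Adjacency in the brickwall `𝓑`: vertex `(i,j)` is `b_{i,j}`.
Horizontal edges `b_{i,j} b_{i+1,j}` for all `i,j`, and vertical edges
`b_{i,j} b_{i+1,j+1}` for odd `i`. -/
def bwAdj (u v : ℤ × ℤ) : Prop :=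
  (u.2 = v.2 ∧ (v.1 = u.1 + 1 ∨ u.1 = v.1 + 1)) ∨
  (Odd u.1 ∧ v.1 = u.1 + 1 ∧ v.2 = u.2 + 1) ∨
  (Odd v.1 ∧ u.1 = v.1 + 1 ∧ u.2 = v.2 + 1)

/-- A closed walk of length `k` in the brickwall, represented by a `k`-periodic
function `f : ℤ → ℤ × ℤ` (so `W_i = f i`), with adjacency and no turning back. -/
def IsClosedWalk (k : ℕ) (f : ℤ → ℤ × ℤ) : Prop :=
  0 < k ∧ (∀ i : ℤ, f (i + (k : ℤ)) = f i) ∧ (∀ i : ℤ, bwAdj (f i) (f (i + 1))) ∧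
    (∀ i : ℤ, f (i - 1) ≠ f (i + 1))

/-- The neighbor of `v` immediately following `u` in the clockwise order
around `v` in the planar drawing of the brickwall:
around `b_{i,j}` with `i` odd the clockwise order is
`(b_{i+1,j+1}, b_{i+1,j}, b_{i-1,j})`, and with `i` even it is
`(b_{i+1,j}, b_{i-1,j-1}, b_{i-1,j})`. -/
def cwNext (v u : ℤ × ℤ) : ℤ × ℤ :=
  if v.1 % 2 = 0 then
    (if u = (v.1 + 1, v.2) then (v.1 - 1, v.2 - 1)
     else if u = (v.1 - 1, v.2 - 1) then (v.1 - 1, v.2)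
     else (v.1 + 1, v.2))
  else
    (if u = (v.1 + 1, v.2 + 1) then (v.1 + 1, v.2)
     else if u = (v.1 + 1, v.2) then (v.1 - 1, v.2)
     else (v.1 + 1, v.2 + 1))

/-- `W` makes a right turn at `i`: `W_{i-1}` immediately follows `W_{i+1}` clockwise. -/
def RightTurn (f : ℤ → ℤ × ℤ) (i : ℤ) : Prop := f (i - 1) = cwNext (f i) (f (i + 1))

/-- `W` makes a left turn at `i`: `W_{i+1}` immediately follows `W_{i-1}` clockwise. -/
def LeftTurn (f : ℤ → ℤ × ℤ) (i : ℤ) : Prop := f (i + 1) = cwNext (f i) (f (i - 1))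

noncomputable def rightCount (k : ℕ) (f : ℤ → ℤ × ℤ) : ℕ :=
  ((Finset.range k).filter fun t => RightTurn f (t : ℤ)).card

noncomputable def leftCount (k : ℕ) (f : ℤ → ℤ × ℤ) : ℕ :=
  ((Finset.range k).filter fun t => LeftTurn f (t : ℤ)).card

/-- The turning number `t(W) = (Right(W) - Left(W))/6`. -/
noncomputable def turningNumber (k : ℕ) (f : ℤ → ℤ × ℤ) : ℚ :=
  ((rightCount k f : ℚ) - (leftCount k f : ℚ)) / 6

/-- `uv` is a horizontal right edge: same height, smaller first coordinate even. -/
def HorizRight (u v : ℤ × ℤ) : Prop := u.2 = v.2 ∧ Even (min u.1 v.1)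

/-- `uv` is a horizontal left edge: same height, smaller first coordinate odd. -/
def HorizLeft (u v : ℤ × ℤ) : Prop := u.2 = v.2 ∧ Odd (min u.1 v.1)

/-- A right-turn walk: every vertical edge is immediately followed by a horizontal
right edge and immediately preceded by a horizontal left edge. -/
def IsRightTurnWalk (f : ℤ → ℤ × ℤ) : Prop :=
  ∀ i : ℤ, (f i).2 ≠ (f (i + 1)).2 →
    HorizRight (f (i + 1)) (f (i + 2)) ∧ HorizLeft (f (i - 1)) (f i)

/-- The unique neighbor of `W_i` other than `W_{i-1}` and `W_{i+1}`. -/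
def thirdNb (f : ℤ → ℤ × ℤ) (i : ℤ) : ℤ × ℤ :=
  if cwNext (f i) (f (i + 1)) = f (i - 1) then cwNext (f i) (f (i - 1))
  else cwNext (f i) (f (i + 1))

/-- `i ∈ {0,…,k-1}` is a PA-index: `W` makes a left turn at `i` and the third
neighbor of `W_i` has the same height as `W_i`. -/
def IsPAIndex (k : ℕ) (f : ℤ → ℤ × ℤ) (i : ℤ) : Prop :=
  0 ≤ i ∧ i < (k : ℤ) ∧ LeftTurn f i ∧ (thirdNb f i).2 = (f i).2

/-- The horizontal path in the brickwall from `u` to `v` (same height), as a list. -/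
def horizPath (u v : ℤ × ℤ) : List (ℤ × ℤ) :=
  if u.1 ≤ v.1 then (List.range ((v.1 - u.1).toNat + 1)).map fun t => (u.1 + (t : ℤ), u.2)
  else (List.range ((u.1 - v.1).toNat + 1)).map fun t => (u.1 - (t : ℤ), u.2)

/-- `p = {x,y}` is a possible assignment (PA) of the closed walk. -/
def IsPA (k : ℕ) (f : ℤ → ℤ × ℤ) (p : Finset ℤ) : Prop :=
  ∃ x y : ℤ, p = {x, y} ∧ IsPAIndex k f x ∧ IsPAIndex k f y ∧
    f x ≠ f y ∧ (f x).2 = (f y).2 ∧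
    ∀ z ∈ horizPath (f x) (f y),
      z ≠ f (x - 1) ∧ z ≠ f (x + 1) ∧ z ≠ f (y - 1) ∧ z ≠ f (y + 1)

/-- A proper assignment set: a set of PAs forming a non-crossing perfect matching
on the PA-indices. -/
def IsProperAssignment (k : ℕ) (f : ℤ → ℤ × ℤ) (A : Set (Finset ℤ)) : Prop :=
  (∀ p ∈ A, IsPA k f p) ∧
  (∀ i : ℤ, IsPAIndex k f i → ∃! p, p ∈ A ∧ i ∈ p) ∧
  (∀ p ∈ A, ∀ q ∈ A, ∀ i ∈ p, ∀ j ∈ p, ∀ x ∈ q, ∀ y ∈ q, ¬(i < x ∧ x < j ∧ j < y))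

/-- `n(i)`: the first PA-index strictly after `i` in cyclic order
(minimizing the cyclic distance `((j - i - 1) mod k) + 1`). -/
noncomputable def nextPA (k : ℕ) (f : ℤ → ℤ × ℤ) (i : ℤ) : ℤ :=
  if h : ∃ j : ℤ, IsPAIndex k f j ∧ ∀ j' : ℤ, IsPAIndex k f j' →
      (j - i - 1) % (k : ℤ) ≤ (j' - i - 1) % (k : ℤ)
  then h.choose else 0

/-- The subwalk `W_{x,y}` of the closed walk, as a list of `((y-x) mod k) + 1` vertices. -/
def subwalkList (k : ℕ) (f : ℤ → ℤ × ℤ) (x y : ℤ) : List (ℤ × ℤ) :=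
  (List.range (((y - x) % (k : ℤ)).toNat + 1)).map fun t => f (x + (t : ℤ))

/-- The cyclic function `ℤ → ℤ × ℤ` determined by a list of vertices. -/
def listFun (L : List (ℤ × ℤ)) : ℤ → ℤ × ℤ :=
  fun z => L.getD ((z % (L.length : ℤ)).toNat) (0, 0)

/-- An elementary cycle of `(W, A)`, given by its index sequence
`i_0, …, i_l` of PA-indices with `{n(i_t), i_{t+1}} ∈ A`, `{n(i_l), i_0} ∈ A`,
and canonical rotation `i_0 < i_t` for `t ≥ 1`. -/
structure ElemCycle (k : ℕ) (f : ℤ → ℤ × ℤ) (A : Set (Finset ℤ)) where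
  l : ℕ
  idx : ℕ → ℤ
  pa : ∀ t : ℕ, t ≤ l → IsPAIndex k f (idx t)
  mem : ∀ t : ℕ, t < l → ({nextPA k f (idx t), idx (t + 1)} : Finset ℤ) ∈ A
  memLast : ({nextPA k f (idx l), idx 0} : Finset ℤ) ∈ A
  minimal : ∀ t : ℕ, 1 ≤ t → t ≤ l → idx 0 < idx t
  canon : ∀ t : ℕ, l < t → idx t = idx 0

/-- The `t`-th segment `W_{i_t, n(i_t)} ∘ H_{n(i_t), i_{t+1}}` of an elementary
cycle (with final vertex dropped, for concatenation). -/
noncomputable def ecSegment {k : ℕ} {f : ℤ → ℤ × ℤ} {A : Set (Finset ℤ)}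
    (E : ElemCycle k f A) (t : ℕ) : List (ℤ × ℤ) :=
  (subwalkList k f (E.idx t) (nextPA k f (E.idx t))).dropLast ++
  (horizPath (f (nextPA k f (E.idx t))) (f (E.idx (if t = E.l then 0 else t + 1)))).dropLast

/-- The closed walk `C = W_{i_0,n(i_0)} ∘ H_{n(i_0),i_1} ∘ ⋯ ∘ H_{n(i_l),i_0}` of an
elementary cycle, as a list (without the repeated final vertex). -/
noncomputable def ecOpenList {k : ℕ} {f : ℤ → ℤ × ℤ} {A : Set (Finset ℤ)}
    (E : ElemCycle k f A) : List (ℤ × ℤ) :=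
  (List.range (E.l + 1)).flatMap (ecSegment E)

/-- The length of the closed walk of an elementary cycle. -/
noncomputable def ecLen {k : ℕ} {f : ℤ → ℤ × ℤ} {A : Set (Finset ℤ)}
    (E : ElemCycle k f A) : ℕ := (ecOpenList E).length

/-- The closed walk of an elementary cycle, as a periodic function. -/
noncomputable def ecFun {k : ℕ} {f : ℤ → ℤ × ℤ} {A : Set (Finset ℤ)}
    (E : ElemCycle k f A) : ℤ → ℤ × ℤ := listFun (ecOpenList E)

/-- `(m, g)` is (the closed walk of) an elementary cycle of `(W, A)`; if `A = ∅`
and `W` has no PA-index, `W` itself is the unique elementary cycle. -/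
def IsElemCycleWalk (k : ℕ) (f : ℤ → ℤ × ℤ) (A : Set (Finset ℤ))
    (m : ℕ) (g : ℤ → ℤ × ℤ) : Prop :=
  (∃ E : ElemCycle k f A, m = ecLen E ∧ g = ecFun E) ∨
  (A = ∅ ∧ (∀ i : ℤ, ¬ IsPAIndex k f i) ∧ m = k ∧ g = f)

/-- The number of elementary cycles of `(W, A)` (elementary cycles being
identified with their index sequences). -/
noncomputable def numElemCycles (k : ℕ) (f : ℤ → ℤ × ℤ) (A : Set (Finset ℤ)) : ℕ :=
  if A = ∅ ∧ ∀ i : ℤ, ¬ IsPAIndex k f i then 1 else Nat.card (ElemCycle k f A)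

/-- The number of PA-indices of the closed walk. -/
noncomputable def paCount (k : ℕ) (f : ℤ → ℤ × ℤ) : ℕ :=
  Nat.card {i : ℤ // IsPAIndex k f i}

/-- The walk `W' = W_{0,y} ∘ H_{y,0}`, as a list (without repeated final vertex). -/
noncomputable def splitList (k : ℕ) (f : ℤ → ℤ × ℤ) (y : ℤ) : List (ℤ × ℤ) :=
  (subwalkList k f 0 y).dropLast ++ (horizPath (f y) (f 0)).dropLast

/-- The length of the walk `W' = W_{0,y} ∘ H_{y,0}`. -/
noncomputable def splitLen (k : ℕ) (f : ℤ → ℤ × ℤ) (y : ℤ) : ℕ := (splitList k f y).length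

/-- The walk `W' = W_{0,y} ∘ H_{y,0}`, as a periodic function. -/
noncomputable def splitFun (k : ℕ) (f : ℤ → ℤ × ℤ) (y : ℤ) : ℤ → ℤ × ℤ :=
  listFun (splitList k f y)

/-- `Σ_{C ∈ 𝒞} (t(C) - 1)` over the set `𝒞` of elementary cycles of `(W, A)`. -/
noncomputable def elemTurnSum (k : ℕ) (f : ℤ → ℤ × ℤ) (A : Set (Finset ℤ)) : ℚ :=
  if A = ∅ ∧ ∀ i : ℤ, ¬ IsPAIndex k f i then turningNumber k f - 1
  else ∑ᶠ E : ElemCycle k f A, (turningNumber (ecLen E) (ecFun E) - 1)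

/-! ### Turns along lists of vertices -/

/-- The turn made at `v` when going from `u` via `v` to `w`: `1` for a right turn,
`-1` for a left turn. -/
noncomputable def turn (u v w : ℤ × ℤ) : ℤ :=
  (if u = cwNext v w then 1 else 0) - (if w = cwNext v u then 1 else 0)

lemma turn_swap (u v w : ℤ × ℤ) : turn w v u = -turn u v w := by
  unfold turn; ring

/-- The total turn along an open walk given as a list. -/
noncomputable def listTurn : List (ℤ × ℤ) → ℤ
  | a :: b :: c :: l => turn a b c + listTurn (b :: c :: l)
  | _ => 0

lemma listTurn_append (P Q : List (ℤ × ℤ)) (a b : ℤ × ℤ) :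
    listTurn (P ++ a :: b :: Q) = listTurn (P ++ [a, b]) + listTurn (a :: b :: Q) := by
  match P with
  | [] => simp [listTurn]
  | [p] => simp [listTurn]
  | [p, q] => simp [listTurn]; ring
  | p :: q :: r :: P =>
    have := listTurn_append (q :: r :: P) Q a b
    simp only [List.cons_append, listTurn] at this ⊢
    rw [this]; ring

lemma listTurn_reverse (L : List (ℤ × ℤ)) : listTurn L.reverse = -listTurn L := by
  match L with
  | [] => simp [listTurn]
  | [p] => simp [listTurn]
  | [p, q] => simp [listTurn]
  | a :: b :: c :: l =>
    have ih := listTurn_reverse (b :: c :: l)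
    have h := listTurn_append l.reverse [a] c b
    simp only [List.reverse_cons, List.append_assoc, List.cons_append, List.nil_append,
      listTurn] at ih h ⊢
    rw [h, ih, turn_swap a b c]; ring

lemma listTurn_eq_sum (L : List (ℤ × ℤ)) :
    listTurn L = ∑ r ∈ Finset.range (L.length - 2),
      turn (L.getD r (0, 0)) (L.getD (r + 1) (0, 0)) (L.getD (r + 2) (0, 0)) := by
  match L with
  | [] => simp [listTurn]
  | [p] => simp [listTurn]
  | [p, q] => simp [listTurn]
  | a :: b :: c :: l =>
    have ih := listTurn_eq_sum (b :: c :: l)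
    have e : (a :: b :: c :: l).length - 2 = ((b :: c :: l).length - 2) + 1 := by simp
    rw [e, Finset.sum_range_succ', listTurn, ih]
    simp only [List.getD_cons_succ, List.getD_cons_zero]
    ring

lemma listTurn_map_range (g : ℕ → ℤ × ℤ) (e : ℕ) :
    listTurn ((List.range (e + 2)).map g) =
      ∑ r ∈ Finset.range e, turn (g r) (g (r + 1)) (g (r + 2)) := by
  rw [listTurn_eq_sum]
  simp only [List.length_map, List.length_range, Nat.add_sub_cancel]
  refine Finset.sum_congr rfl fun r hr => ?_
  have := Finset.mem_range.1 hr
  have h : ∀ s, s < e + 2 → ((List.range (e + 2)).map g).getD s (0, 0) = g s := by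
    intro s hs
    simp [List.getD_eq_getElem?_getD, hs]
  rw [h _ (by omega), h _ (by omega), h _ (by omega)]

/-- Concatenating two walks overlapping in a vertex, followed by one more step. -/
lemma listTurn_join (P Q Q' : List (ℤ × ℤ)) (u v w w' v' z : ℤ × ℤ)
    (h : v :: w :: Q = Q' ++ [w', v']) :
    listTurn (P ++ [u] ++ (v :: w :: Q) ++ [z]) =
      listTurn (P ++ [u, v]) + turn u v w + listTurn (v :: w :: Q) + turn w' v' z := by
  have h1 := listTurn_append P (w :: (Q ++ [z])) u v
  have h2 : listTurn (v :: w :: (Q ++ [z])) = listTurn (v :: w :: Q) + turn w' v' z := by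
    have h3 := listTurn_append Q' [z] w' v'
    have e : v :: w :: (Q ++ [z]) = Q' ++ w' :: v' :: [z] := by
      have : v :: w :: (Q ++ [z]) = (v :: w :: Q) ++ [z] := by simp
      rw [this, h]; simp
    rw [e, h, h3]; simp [listTurn]
  simp only [List.append_assoc, List.cons_append, List.nil_append]
  rw [h1, listTurn, h2]; ring

/-- The total turn along a concatenation of nontrivial walks. -/
lemma listTurn_flatMap (a b : ℕ → ℤ × ℤ) (S R : ℕ → List (ℤ × ℤ)) (m : ℕ)
    (hS : ∀ t < m, S t = a t :: b t :: R t) :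
    listTurn ((List.range m).flatMap S ++ [a m, b m]) =
      ∑ t ∈ Finset.range m, listTurn (S t ++ [a (t + 1), b (t + 1)]) := by
  induction m with
  | zero => simp [listTurn]
  | succ m ih =>
    rw [Finset.sum_range_succ, ← ih fun t ht => hS t (by omega), List.range_succ,
      List.flatMap_append, hS m (by omega)]
    simp only [List.flatMap_cons, List.flatMap_nil, List.append_nil, hS m (by omega),
      List.append_assoc, List.cons_append]
    exact listTurn_append _ _ _ _

lemma turningNumber_eq_sum (k : ℕ) (f : ℤ → ℤ × ℤ) :
    turningNumber k f =
      ((∑ z ∈ Finset.range k, turn (f ((z : ℤ) - 1)) (f z) (f ((z : ℤ) + 1)) : ℤ) : ℚ) / 6 := by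
  have hcard (p : ℤ → Prop) : ((do let a ← Finset.range k; pure (a : ℤ)).filter p).card =
      ((Finset.range k).filter fun t : ℕ => p t).card := by
    symm
    refine Finset.card_bij (fun t _ => (t : ℤ)) ?_ ?_ ?_
    · intro a ha
      simpa using ha
    · intro a _ b _ h
      exact_mod_cast h
    · intro b hb
      simp at hb
      grind
  unfold turningNumber rightCount leftCount turn RightTurn LeftTurn
  rw [Finset.sum_sub_distrib, Finset.sum_boole, Finset.sum_boole, hcard, hcard]
  push_cast
  congr!

lemma turningNumber_listFun (a b : ℤ × ℤ) (R : List (ℤ × ℤ)) :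
    turningNumber (a :: b :: R).length (listFun (a :: b :: R)) =
      (listTurn ((a :: b :: R) ++ [a, b]) : ℚ) / 6 := by
  rw [turningNumber_eq_sum, listTurn_eq_sum]
  congr 2
  set L := a :: b :: R with hL
  have hlen : L.length = R.length + 2 := by simp [hL]
  have hper : ∀ z : ℤ, listFun L (z + L.length) = listFun L z := by
    intro z; simp [listFun]
  have hX : ∀ r : ℕ, r < L.length + 2 → (L ++ [a, b]).getD r (0, 0) = listFun L r := by
    intro r hr
    rcases lt_or_ge r L.length with h | h
    · have : ((r : ℤ) % (L.length : ℤ)).toNat = r := by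
        rw [Int.emod_eq_of_lt (by omega) (by omega)]; simp
      simp [listFun, this, List.getD_eq_getElem?_getD, List.getElem?_append_left h]
    · obtain ⟨s, rfl⟩ := Nat.exists_eq_add_of_le h
      have e : ((L.length + s : ℕ) : ℤ) = (s : ℤ) + L.length := by push_cast; ring
      rw [e, hper, List.getD_append_right _ _ _ _ (by omega)]
      have hs : s < 2 := by omega
      have : ((s : ℤ) % (L.length : ℤ)).toNat = s := by
        rw [Int.emod_eq_of_lt (by omega) (by omega)]; simp
      rw [listFun, this, hL]
      interval_cases s
      all_goals simp
  set h : ℕ → ℤ := fun z => turn (listFun L ((z : ℤ) - 1)) (listFun L z) (listFun L ((z : ℤ) + 1))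
    with hh
  have key : ∑ z ∈ Finset.range L.length, h (z + 1) = ∑ z ∈ Finset.range L.length, h z := by
    have h1 := Finset.sum_range_succ h L.length
    have h2 := Finset.sum_range_succ' h L.length
    have h3 : h L.length = h 0 := by
      have e1 := hper (-1)
      have e2 := hper 0
      have e3 := hper 1
      simp only [hh]
      rw [show (L.length : ℤ) - 1 = -1 + L.length by ring, e1,
        show (L.length : ℤ) + 1 = 1 + L.length by ring, e3,
        show (L.length : ℤ) = 0 + L.length by ring, e2]
      simp
    linarith
  rw [← key]
  have e : (L ++ [a, b]).length - 2 = L.length := by simp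
  rw [e]
  refine Finset.sum_congr rfl fun r hr => ?_
  have := Finset.mem_range.1 hr
  rw [hX _ (by omega), hX _ (by omega), hX _ (by omega)]
  simp only [hh]
  push_cast
  congr 2
  all_goals ring

/-! ### Local geometry of the brickwall -/

lemma bwAdj_cases_of_even {v a : ℤ × ℤ} (hv : v.1 % 2 = 0) (ha : bwAdj v a) :
    a = (v.1 + 1, v.2) ∨ a = (v.1 - 1, v.2 - 1) ∨ a = (v.1 - 1, v.2) := by
  simp only [bwAdj, Int.odd_iff, Prod.ext_iff] at *
  omega

lemma bwAdj_cases_of_odd {v a : ℤ × ℤ} (hv : v.1 % 2 ≠ 0) (ha : bwAdj v a) :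
    a = (v.1 + 1, v.2 + 1) ∨ a = (v.1 + 1, v.2) ∨ a = (v.1 - 1, v.2) := by
  simp only [bwAdj, Int.odd_iff, Prod.ext_iff] at *
  omega

lemma cwNext_ne {v a : ℤ × ℤ} (ha : bwAdj v a) : cwNext v a ≠ a := by
  have e : ∀ x : ℤ, ¬ x - 1 = x + 1 := fun x => by omega
  have e' : ∀ x : ℤ, ¬ x + 1 = x - 1 := fun x => by omega
  have e'' : ∀ x : ℤ, ¬ x = x - 1 := fun x => by omega
  by_cases hv : v.1 % 2 = 0
  · rcases bwAdj_cases_of_even hv ha with rfl | rfl | rfl <;> simp [cwNext, hv, e, e', e'']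
  · rcases bwAdj_cases_of_odd hv ha with rfl | rfl | rfl <;> simp [cwNext, hv, e, e']

lemma cwNext_cwNext {v a w : ℤ × ℤ} (ha : bwAdj v a) (hw : bwAdj v w)
    (hwa : w ≠ a) (hwb : w ≠ cwNext v a) : cwNext v (cwNext v a) = w ∧ cwNext v w = a := by
  have e : ∀ x : ℤ, ¬ x - 1 = x + 1 := fun x => by omega
  have e' : ∀ x : ℤ, ¬ x + 1 = x - 1 := fun x => by omega
  have e'' : ∀ x : ℤ, ¬ x = x - 1 := fun x => by omega
  by_cases hv : v.1 % 2 = 0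
  · rcases bwAdj_cases_of_even hv ha with rfl | rfl | rfl <;>
      rcases bwAdj_cases_of_even hv hw with rfl | rfl | rfl <;>
      simp [cwNext, hv, e, e', e''] at hwa hwb ⊢
  · rcases bwAdj_cases_of_odd hv ha with rfl | rfl | rfl <;>
      rcases bwAdj_cases_of_odd hv hw with rfl | rfl | rfl <;>
      simp [cwNext, hv, e, e'] at hwa hwb ⊢

/-- Deviating to the third neighbor `w` from a left turn `a → v → b` gives right turns. -/
lemma turn_of_leftTurn {a v b w : ℤ × ℤ} (ha : bwAdj v a)
    (h : b = cwNext v a) (hw : bwAdj v w) (hwa : w ≠ a) (hwb : w ≠ b) :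
    turn a v w = 1 ∧ turn w v b = 1 ∧ turn a v b = -1 := by
  subst h
  obtain ⟨h1, h2⟩ := cwNext_cwNext ha hw hwa hwb
  have h3 := cwNext_ne ha
  simp [turn, h1, h2, h3, hwa.symm, hwb]

lemma horizPath_eq_of_le (u : ℤ × ℤ) (n : ℕ) :
    horizPath u (u.1 + n, u.2) = (List.range (n + 1)).map fun t : ℕ => (u.1 + (t : ℤ), u.2) := by
  simp [horizPath, ← List.map_eq_flatMap]

lemma horizPath_eq_of_ge (u : ℤ × ℤ) (n : ℕ) :
    horizPath u (u.1 - n, u.2) = (List.range (n + 1)).map fun t : ℕ => (u.1 - (t : ℤ), u.2) := by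
  rcases Nat.eq_zero_or_pos n with rfl | hn
  · simp [horizPath]
  · have : ¬ u.1 ≤ u.1 - n := by omega
    simp [horizPath, hn.ne', ← List.map_eq_flatMap]

lemma horizPath_reverse_nat (u : ℤ × ℤ) (n : ℕ) :
    horizPath (u.1 + n, u.2) u = (horizPath u (u.1 + n, u.2)).reverse := by
  have h := horizPath_eq_of_ge (u.1 + n, u.2) n
  simp only [add_sub_cancel_right] at h
  rw [horizPath_eq_of_le, h]
  apply List.ext_getElem (by simp)
  intro i h1 h2
  simp at h1 ⊢
  omega

lemma horizPath_reverse {u v : ℤ × ℤ} (h : u.2 = v.2) :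
    horizPath v u = (horizPath u v).reverse := by
  rcases le_total u.1 v.1 with h1 | h1
  · obtain ⟨n, hn⟩ := Int.eq_ofNat_of_zero_le (sub_nonneg.2 h1)
    have : v = (u.1 + n, u.2) := Prod.ext (by simp; omega) (by simp [h])
    rw [this, horizPath_reverse_nat]
  · obtain ⟨n, hn⟩ := Int.eq_ofNat_of_zero_le (sub_nonneg.2 h1)
    have : u = (v.1 + n, v.2) := Prod.ext (by simp; omega) (by simp [h])
    rw [this, horizPath_reverse_nat, List.reverse_reverse]

/-- A nontrivial horizontal path starts with an edge. -/
lemma horizPath_eq_cons {u v : ℤ × ℤ} (h : u.2 = v.2) (hne : u ≠ v) :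
    ∃ w Q, horizPath u v = u :: w :: Q ∧ bwAdj u w := by
  rcases le_total u.1 v.1 with h1 | h1
  · obtain ⟨n, hn⟩ := Int.eq_ofNat_of_zero_le (sub_nonneg.2 h1)
    have hv : v = (u.1 + n, u.2) := Prod.ext (by simp; omega) (by simp [h])
    obtain _ | m := n
    · exact absurd (by simp [hv]) hne
    rw [hv, horizPath_eq_of_le, List.range_succ_eq_map, List.range_succ_eq_map]
    refine ⟨(u.1 + 1, u.2), _, by simp; rfl, by simp [bwAdj]⟩
  · obtain ⟨n, hn⟩ := Int.eq_ofNat_of_zero_le (sub_nonneg.2 h1)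
    have hv : v = (u.1 - n, u.2) := Prod.ext (by simp; omega) (by simp [h])
    obtain _ | m := n
    · exact absurd (by simp [hv]) hne
    rw [hv, horizPath_eq_of_ge, List.range_succ_eq_map, List.range_succ_eq_map]
    refine ⟨(u.1 - 1, u.2), _, by simp; rfl, by simp [bwAdj]⟩

/-! ### Orbits of an injective self-map of a finite linear order -/

section Orbits

variable {P : Type*} [Fintype P]

lemma exists_iterate_iterate_eq {s : P → P} (hs : Function.Injective s) (i : P) (t : ℕ) :
    ∃ r, s^[r] (s^[t] i) = i := by
  obtain ⟨p, hp, hpi⟩ := hs.mem_periodicPts i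
  refine ⟨t * p - t, ?_⟩
  rw [← Function.iterate_add_apply, Nat.sub_add_cancel (Nat.le_mul_of_pos_right t hp)]
  exact hpi.const_mul t

variable [LinearOrder P]

/-- The elements that are the least in their orbit under `s`. -/
noncomputable def orbitMins (s : P → P) : Finset P :=
  Finset.univ.filter fun m => ∀ t, m ≤ s^[t] m

lemma sum_orbitMins {s : P → P} (hs : Function.Injective s) (F : P → ℤ) :
    ∑ m ∈ orbitMins s, ∑ t ∈ Finset.range (Function.minimalPeriod s m), F (s^[t] m) =
      ∑ i, F i := by
  have hpos (m : P) : 0 < Function.minimalPeriod s m :=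
    Function.minimalPeriod_pos_of_mem_periodicPts (hs.mem_periodicPts m)
  rw [Finset.sum_sigma']
  refine Finset.sum_bij (fun x _ => s^[x.2] x.1) (fun _ _ => Finset.mem_univ _) ?_ ?_
    (fun _ _ => rfl)
  · rintro ⟨m, t⟩ hx ⟨m', t'⟩ hx' h
    simp only [orbitMins, Finset.mem_sigma, Finset.mem_filter, Finset.mem_univ, true_and,
      Finset.mem_range] at hx hx' h
    have hm : m = m' := by
      apply le_antisymm
      · obtain ⟨r, hr⟩ := exists_iterate_iterate_eq hs m' t'
        rw [← hr, ← h, ← Function.iterate_add_apply]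
        exact hx.1 _
      · obtain ⟨r, hr⟩ := exists_iterate_iterate_eq hs m t
        rw [← hr, h, ← Function.iterate_add_apply]
        exact hx'.1 _
    subst hm
    have := Function.iterate_injOn_Iio_minimalPeriod hx.2 hx'.2 h
    simp [this]
  · intro i _
    obtain ⟨m, ⟨t, rfl⟩, hm⟩ := wellFounded_lt.has_min (Set.range fun t => s^[t] i) ⟨i, 0, rfl⟩
    obtain ⟨r, hr⟩ := exists_iterate_iterate_eq hs i t
    refine ⟨⟨s^[t] i, r % Function.minimalPeriod s (s^[t] i)⟩, ?_, ?_⟩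
    · simp only [orbitMins, Finset.mem_sigma, Finset.mem_filter, Finset.mem_univ, true_and,
        Finset.mem_range]
      refine ⟨fun u => not_lt.1 (hm _ ⟨u + t, ?_⟩), Nat.mod_lt _ (hpos _)⟩
      exact Function.iterate_add_apply _ _ _ _
    · simp only [Function.iterate_mod_minimalPeriod_eq]
      exact hr

/-- A noncrossing perfect matching `M` on `n` cyclically ordered points, with cyclic
successor `nx`, has `n / 2 + 1` faces. -/
lemma card_orbitMins_of_noncrossing {M nx : P → P} (hM : Function.Involutive M)
    (hne : ∀ i, M i ≠ i) (hcross : ∀ i x, ¬ (i < x ∧ x < M i ∧ M i < M x))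
    (hnx : Function.Injective nx) (hlt : ∀ i j, i < j → i < nx i ∧ nx i ≤ j)
    (htop : ∀ i, (∀ j, j ≤ i) → ∀ j, nx i ≤ j) {b : P} (hb : ∀ j, b ≤ j) :
    2 * (orbitMins (M ∘ nx)).card = Fintype.card P + 2 := by
  have hs : Function.Injective (M ∘ nx) := hM.injective.comp hnx
  have step (a i : P) (h1 : a ≤ i) (h2 : i < M a) : a ≤ M (nx i) ∧ M (nx i) < M a := by
    obtain ⟨h3, h4⟩ := hlt i (M a) h2
    rcases h4.eq_or_lt with h4 | h4
    · rw [h4, hM a]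
      exact ⟨le_rfl, h1.trans_lt h2⟩
    · have h5 := h1.trans_lt h3
      refine ⟨?_, ?_⟩
      · by_contra! h
        exact hcross (M (nx i)) a ⟨h, by rwa [hM], by rwa [hM]⟩
      · refine lt_of_le_of_ne (not_lt.1 fun h => hcross a (nx i) ⟨h5, h4, h⟩) fun h => ?_
        exact h5.ne' (hM.injective h)
  have inv (a i : P) (h1 : a ≤ i) (h2 : i < M a) (t : ℕ) :
      a ≤ (M ∘ nx)^[t] i ∧ (M ∘ nx)^[t] i < M a := by
    induction t with
    | zero => exact ⟨h1, h2⟩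
    | succ t ih =>
      rw [Function.iterate_succ_apply']
      exact step a _ ih.1 ih.2
  have hbM : b < M b := lt_of_le_of_ne (hb _) (hne b).symm
  have key : orbitMins (M ∘ nx) = insert (M b) (Finset.univ.filter fun i => i < M i) := by
    ext i
    simp only [orbitMins, Finset.mem_filter, Finset.mem_univ, true_and, Finset.mem_insert]
    constructor
    · intro h
      by_contra! hi
      have hlt' : M i < i := lt_of_le_of_ne hi.2 (hne i)
      obtain ⟨j, hj⟩ := (Finite.injective_iff_surjective.1 hnx) (M i)
      have hex : ∃ j', j < j' := by
        by_contra! hj'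
        have h0 : M i = b := le_antisymm (hj ▸ htop j hj' b) (hb _)
        exact hi.1 (by rw [← h0, hM])
      obtain ⟨j', hj'⟩ := hex
      have hji : j < i := ((hlt j j' hj').1.trans_eq hj).trans hlt'
      obtain ⟨r, hr⟩ := exists_iterate_iterate_eq hs j 1
      have h1 : (M ∘ nx)^[1] j = i := by simp [hj, hM i]
      rw [h1] at hr
      exact absurd (h r) (by rw [hr]; exact not_le.2 hji)
    · rintro (rfl | h) t
      · by_contra! h
        obtain ⟨r, hr⟩ := exists_iterate_iterate_eq hs (M b) t
        have := (inv b _ (hb _) h r).2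
        rw [hr] at this
        exact lt_irrefl _ this
      · exact (inv i i le_rfl h t).1
  have hcard : (Finset.univ.filter fun i => i < M i).card =
      (Finset.univ.filter fun i => ¬ i < M i).card := by
    refine Finset.card_bij (fun i _ => M i) ?_ (fun _ _ _ _ h => hM.injective h) ?_
    · intro i hi
      simp only [Finset.mem_filter, Finset.mem_univ, true_and] at hi ⊢
      rw [hM]
      exact hi.le.not_gt
    · intro i hi
      simp only [Finset.mem_filter, Finset.mem_univ, true_and] at hi
      refine ⟨M i, ?_, hM i⟩
      simp only [Finset.mem_filter, Finset.mem_univ, true_and, hM i]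
      exact lt_of_le_of_ne (not_lt.1 hi) (hne i)
  have htot := Finset.card_filter_add_card_filter_not (s := (Finset.univ : Finset P))
    (fun i => i < M i)
  rw [key, Finset.card_insert_of_notMem]
  · rw [Finset.card_univ] at htot
    omega
  · simp only [Finset.mem_filter, Finset.mem_univ, true_and, hM b]
    exact hbM.le.not_gt

end Orbits

/-! ### PA-indices, their cyclic successors and partners -/

/-- The type of PA-indices of a closed walk. -/
abbrev PAIdx (k : ℕ) (f : ℤ → ℤ × ℤ) : Type := {i : ℤ // IsPAIndex k f i}

noncomputable instance (k : ℕ) (f : ℤ → ℤ × ℤ) : Fintype (PAIdx k f) :=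
  ((Set.finite_Ico (0 : ℤ) k).subset fun _ h => ⟨h.1, h.2.1⟩ : {i | IsPAIndex k f i}.Finite).fintype

variable {k : ℕ} {f : ℤ → ℤ × ℤ} {A : Set (Finset ℤ)}

lemma nextPA_spec (i : PAIdx k f) : IsPAIndex k f (nextPA k f i) ∧
    ∀ j, IsPAIndex k f j → (nextPA k f i - i - 1) % (k : ℤ) ≤ (j - i - 1) % (k : ℤ) := by
  have h : ∃ j : ℤ, IsPAIndex k f j ∧ ∀ j' : ℤ, IsPAIndex k f j' →
      (j - i - 1) % (k : ℤ) ≤ (j' - i - 1) % (k : ℤ) := by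
    obtain ⟨j, -, hj⟩ := Finset.exists_min_image (Finset.univ : Finset (PAIdx k f))
      (fun j => ((j : ℤ) - i - 1) % (k : ℤ)) ⟨i, Finset.mem_univ _⟩
    exact ⟨j, j.2, fun j' hj' => hj ⟨j', hj'⟩ (Finset.mem_univ _)⟩
  rw [nextPA, dif_pos h]
  exact h.choose_spec

/-- The cyclic successor on PA-indices. -/
noncomputable def nx (i : PAIdx k f) : PAIdx k f := ⟨nextPA k f i, (nextPA_spec i).1⟩

lemma cyclicDist_eq (i j : PAIdx k f) : ((j : ℤ) - i - 1) % (k : ℤ) =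
    if i < j then (j : ℤ) - i - 1 else j - i - 1 + k := by
  have hi := i.2.1
  have hi' := i.2.2.1
  have hj := j.2.1
  have hj' := j.2.2.1
  split_ifs with h
  · rw [← Subtype.coe_lt_coe] at h
    exact Int.emod_eq_of_lt (by omega) (by omega)
  · rw [← Subtype.coe_lt_coe] at h
    rw [← Int.add_emod_right]
    exact Int.emod_eq_of_lt (by omega) (by omega)

lemma nx_le (i j : PAIdx k f) :
    (((nx i : PAIdx k f) : ℤ) - i - 1) % (k : ℤ) ≤ ((j : ℤ) - i - 1) % (k : ℤ) :=
  (nextPA_spec i).2 j j.2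

lemma nx_of_lt (i j : PAIdx k f) (h : i < j) : i < nx i ∧ nx i ≤ j := by
  have h1 := nx_le i j
  rw [cyclicDist_eq, cyclicDist_eq, if_pos h] at h1
  have h2 := (nx i).2.1
  have h3 := j.2.2.1
  split_ifs at h1 with h4
  · exact ⟨h4, Subtype.coe_le_coe.1 (by omega)⟩
  · omega

lemma nx_of_top (i : PAIdx k f) (h : ∀ j, j ≤ i) (j : PAIdx k f) : nx i ≤ j := by
  have h1 := nx_le i j
  rw [cyclicDist_eq, cyclicDist_eq, if_neg (h _).not_gt, if_neg (h _).not_gt] at h1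
  exact Subtype.coe_le_coe.1 (by omega)

lemma nx_injective : Function.Injective (nx : PAIdx k f → PAIdx k f) := by
  have key (i j : PAIdx k f) (h : i < j) : nx i ≠ nx j := by
    obtain ⟨h1, h2⟩ := nx_of_lt i j h
    intro e
    by_cases ht : ∃ j', j < j'
    · obtain ⟨j', hj'⟩ := ht
      exact absurd (nx_of_lt j j' hj').1 (by rw [← e]; exact h2.not_gt)
    · push Not at ht
      exact absurd (nx_of_top j ht i) (by rw [← e]; exact h1.not_ge)
  intro i j h
  rcases lt_trichotomy i j with h' | h' | h'
  · exact absurd h (key i j h')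
  · exact h'
  · exact absurd h.symm (key j i h')

/-- `M` sends every PA-index to its partner in the proper assignment set `A`. -/
structure IsPairing (A : Set (Finset ℤ)) (M : PAIdx k f → PAIdx k f) : Prop where
  involutive : Function.Involutive M
  mem_iff : ∀ (i : PAIdx k f) (j : ℤ), ({(i : ℤ), j} : Finset ℤ) ∈ A ↔ j = M i
  noncrossing : ∀ i x, ¬ (i < x ∧ x < M i ∧ M i < M x)
  vertex_ne : ∀ i : PAIdx k f, f i ≠ f (M i)
  height_eq : ∀ i : PAIdx k f, (f i).2 = (f (M i)).2
  avoids : ∀ i : PAIdx k f, ∀ z ∈ horizPath (f i) (f (M i)), z ≠ f (i - 1) ∧ z ≠ f (i + 1)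

lemma exists_partner (hA : IsProperAssignment k f A) (i : PAIdx k f) :
    ∃ j : PAIdx k f, ({(i : ℤ), (j : ℤ)} : Finset ℤ) ∈ A ∧ f i ≠ f j ∧ (f i).2 = (f j).2 ∧
      ∀ z ∈ horizPath (f i) (f j), z ≠ f (i - 1) ∧ z ≠ f (i + 1) := by
  obtain ⟨p, ⟨hp, hip⟩, -⟩ := hA.2.1 i i.2
  obtain ⟨x, y, rfl, hx, hy, hne, hh, hz⟩ := hA.1 p hp
  rcases Finset.mem_insert.1 hip with h | h
  · refine ⟨⟨y, hy⟩, ?_⟩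
    simp only [h]
    exact ⟨hp, hne, hh, fun z hz' => ⟨(hz z hz').1, (hz z hz').2.1⟩⟩
  · rw [Finset.mem_singleton] at h
    refine ⟨⟨x, hx⟩, ?_⟩
    simp only [h]
    refine ⟨by rwa [Finset.pair_comm], hne.symm, hh.symm, fun z hz' => ?_⟩
    rw [horizPath_reverse hh, List.mem_reverse] at hz'
    exact (hz z hz').2.2

lemma exists_isPairing (hA : IsProperAssignment k f A) :
    ∃ M : PAIdx k f → PAIdx k f, IsPairing A M := by
  choose M hMA hMne hMh hMz using exists_partner hA
  have hmem (i : PAIdx k f) (j : ℤ) : ({(i : ℤ), j} : Finset ℤ) ∈ A ↔ j = M i := by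
    refine ⟨fun h => ?_, fun h => h ▸ hMA i⟩
    obtain ⟨p, -, hp⟩ := hA.2.1 i i.2
    have e : ({(i : ℤ), j} : Finset ℤ) = {(i : ℤ), (M i : ℤ)} :=
      (hp _ ⟨h, by simp⟩).trans (hp _ ⟨hMA i, by simp⟩).symm
    have h1 : (M i : ℤ) ∈ ({(i : ℤ), j} : Finset ℤ) := by rw [e]; simp
    rcases Finset.mem_insert.1 h1 with h2 | h2
    · exact absurd (by rw [h2]) (hMne i)
    · exact (Finset.mem_singleton.1 h2).symm
  refine ⟨M, fun i => ?_, hmem, fun i x h => ?_, hMne, hMh, hMz⟩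
  · refine Subtype.ext ((hmem (M i) i).1 ?_).symm
    rw [Finset.pair_comm]
    exact hMA i
  · exact hA.2.2 _ (hMA i) _ (hMA x) i (by simp) (M i) (by simp) x (by simp) (M x) (by simp) h

/-- The least index of an elementary cycle. -/
def ElemCycle.start (E : ElemCycle k f A) : PAIdx k f := ⟨E.idx 0, E.pa 0 (Nat.zero_le _)⟩

namespace IsPairing

variable {M : PAIdx k f → PAIdx k f}

lemma ne (hM : IsPairing A M) (i : PAIdx k f) : M i ≠ i := fun h =>
  hM.vertex_ne i (by rw [h])

lemma nx_ne (hM : IsPairing A M) (i : PAIdx k f) : nx i ≠ i := by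
  by_cases h : ∃ j, i < j
  · obtain ⟨j, hj⟩ := h
    exact (nx_of_lt i j hj).1.ne'
  · push Not at h
    exact ((nx_of_top i h (M i)).trans_lt (lt_of_le_of_ne (h _) (hM.ne i))).ne

lemma comp_injective (hM : IsPairing A M) : Function.Injective (M ∘ nx) :=
  hM.involutive.injective.comp nx_injective

lemma idx_eq (hM : IsPairing A M) (E : ElemCycle k f A) {t : ℕ} (ht : t ≤ E.l) :
    E.idx t = ((M ∘ nx)^[t] E.start : PAIdx k f) := by
  induction t with
  | zero => rfl
  | succ t ih =>
    have h := E.mem t (by omega)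
    rw [ih (by omega)] at h
    rw [Function.iterate_succ_apply']
    exact (hM.mem_iff (nx ((M ∘ nx)^[t] E.start)) _).1 h

lemma iterate_start (hM : IsPairing A M) (E : ElemCycle k f A) :
    (M ∘ nx)^[E.l + 1] E.start = E.start := by
  have h := E.memLast
  rw [hM.idx_eq E le_rfl] at h
  rw [Function.iterate_succ_apply']
  exact Subtype.ext ((hM.mem_iff (nx ((M ∘ nx)^[E.l] E.start)) _).1 h).symm

lemma minimalPeriod_start (hM : IsPairing A M) (E : ElemCycle k f A) :
    Function.minimalPeriod (M ∘ nx) E.start = E.l + 1 := by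
  have h1 : Function.IsPeriodicPt (M ∘ nx) (E.l + 1) E.start := hM.iterate_start E
  have h2 := h1.minimalPeriod_le (by omega)
  have h3 := h1.minimalPeriod_pos (by omega)
  by_contra h
  have h4 := hM.idx_eq E (t := Function.minimalPeriod (M ∘ nx) E.start) (by omega)
  rw [Function.iterate_minimalPeriod] at h4
  exact absurd (E.minimal _ h3 (by omega)) (by rw [h4]; exact lt_irrefl _)

lemma start_mem_orbitMins (hM : IsPairing A M) (E : ElemCycle k f A) :
    E.start ∈ orbitMins (M ∘ nx) := by
  simp only [orbitMins, Finset.mem_filter, Finset.mem_univ, true_and]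
  intro t
  rw [← Function.iterate_mod_minimalPeriod_eq, hM.minimalPeriod_start]
  have ht := Nat.mod_lt t (Nat.succ_pos E.l)
  generalize t % (E.l + 1) = r at ht
  rw [← Subtype.coe_le_coe, ← hM.idx_eq E (by omega)]
  rcases Nat.eq_zero_or_pos r with rfl | hr
  · exact le_rfl
  · exact (E.minimal r hr (by omega)).le

lemma start_injective (hM : IsPairing A M) :
    Function.Injective (ElemCycle.start : ElemCycle k f A → PAIdx k f) := by
  intro E F h
  have hl : E.l = F.l := by
    have h1 := hM.minimalPeriod_start E
    have h2 := hM.minimalPeriod_start F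
    rw [h] at h1
    omega
  have hidx : E.idx = F.idx := by
    funext t
    rcases le_or_gt t E.l with ht | ht
    · rw [hM.idx_eq E ht, hM.idx_eq F (hl ▸ ht), h]
    · rw [E.canon t ht, F.canon t (hl ▸ ht)]
      exact congrArg Subtype.val h
  cases E
  cases F
  simp only at hl hidx
  subst hl hidx
  rfl

lemma range_start (hM : IsPairing A M) :
    Set.range (ElemCycle.start : ElemCycle k f A → PAIdx k f) = orbitMins (M ∘ nx) := by
  ext m
  constructor
  · rintro ⟨E, rfl⟩
    exact hM.start_mem_orbitMins E
  · intro hm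
    simp only [orbitMins, Finset.coe_filter, Finset.mem_univ, true_and, Set.mem_ofPred_eq] at hm
    have hpos : 0 < Function.minimalPeriod (M ∘ nx) m :=
      Function.minimalPeriod_pos_of_mem_periodicPts (hM.comp_injective.mem_periodicPts m)
    obtain ⟨l, hl⟩ := Nat.exists_eq_succ_of_ne_zero hpos.ne'
    have hmem (t : ℕ) : ({nextPA k f ((M ∘ nx)^[t] m).1, ((M ∘ nx)^[t + 1] m).1} : Finset ℤ) ∈ A :=
      (hM.mem_iff (nx ((M ∘ nx)^[t] m)) ((M ∘ nx)^[t + 1] m).1).2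
        (by rw [Function.iterate_succ_apply']; rfl)
    have hlast : (M ∘ nx)^[l + 1] m = m := by
      have := Function.iterate_minimalPeriod (f := M ∘ nx) (x := m)
      rwa [hl] at this
    refine ⟨⟨l, fun t => if t ≤ l then ((M ∘ nx)^[t] m).1 else m.1, ?_, ?_, ?_, ?_, ?_⟩, rfl⟩
    · intro t ht
      rw [if_pos ht]
      exact Subtype.property _
    · intro t ht
      rw [if_pos ht.le, if_pos (Nat.succ_le_of_lt ht)]
      exact hmem t
    · rw [if_pos le_rfl, if_pos (Nat.zero_le _)]
      have := hmem l
      rwa [hlast] at this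
    · intro t h1 h2
      rw [if_pos (Nat.zero_le _), if_pos h2]
      refine lt_of_le_of_ne (hm t) fun h => ?_
      have hp : Function.IsPeriodicPt (M ∘ nx) t m := (Subtype.ext h).symm
      have := hp.minimalPeriod_le h1
      omega
    · intro t ht
      rw [if_neg (by omega), if_pos (Nat.zero_le _)]
      rfl

end IsPairing

/-! ### The turns of elementary cycles -/

/-- The turn of the walk at the index `z`. -/
noncomputable def walkTurn (f : ℤ → ℤ × ℤ) (z : ℤ) : ℤ := turn (f (z - 1)) (f z) (f (z + 1))

/-- The total turn of the walk at the indices `0, …, n - 1`. -/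
noncomputable def partialTurn (f : ℤ → ℤ × ℤ) (n : ℕ) : ℤ :=
  ∑ z ∈ Finset.range n, walkTurn f z

lemma bwAdj_comm {u v : ℤ × ℤ} (h : bwAdj u v) : bwAdj v u := by
  unfold bwAdj at *
  rcases h with ⟨h1, h2⟩ | h | h
  · exact Or.inl ⟨h1.symm, h2.symm⟩
  · exact Or.inr (Or.inr h)
  · exact Or.inr (Or.inl h)

lemma subwalkList_eq (x y : ℤ) : subwalkList k f x y =
    (List.range (((y - x) % (k : ℤ)).toNat + 1)).map fun t : ℕ => f (x + (t : ℤ)) := by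
  simp [subwalkList, ← List.map_eq_flatMap, Function.comp_def]

lemma partialTurn_add_period (hW : IsClosedWalk k f) (n : ℕ) :
    partialTurn f (k + n) = partialTurn f k + partialTurn f n := by
  rw [partialTurn, Finset.sum_range_add]
  congr 1
  refine Finset.sum_congr rfl fun z _ => ?_
  have h1 := hW.2.1 (z - 1)
  have h2 := hW.2.1 z
  have h3 := hW.2.1 (z + 1)
  rw [walkTurn, walkTurn, ← h1, ← h2, ← h3]
  push_cast
  congr 2
  all_goals ring

/-- The turn contributed to an elementary cycle by a PA-index `i`: the walk from `i` to its
successor, the path to the partner of the successor, and the right turns at its ends. -/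
noncomputable def segmentTurn (M : PAIdx k f → PAIdx k f) (i : PAIdx k f) : ℤ :=
  listTurn (subwalkList k f i (nx i : PAIdx k f)) + 2 +
    listTurn (horizPath (f (nx i : PAIdx k f)) (f (M (nx i))))

namespace IsPairing

variable {M : PAIdx k f → PAIdx k f}

/-- The cyclic distance of a PA-index to its successor. -/
lemma exists_gap (hM : IsPairing A M) (i : PAIdx k f) :
    ∃ e : ℕ, (((nx i : PAIdx k f) - i : ℤ) % (k : ℤ)).toNat = e + 1 ∧
      (i : ℤ) + e + 1 = if i < nx i then ((nx i : PAIdx k f) : ℤ) else (nx i : PAIdx k f) + k := by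
  have hi := i.2.1
  have hi' := i.2.2.1
  have hj := (nx i).2.1
  have hj' := (nx i).2.2.1
  have hne : ((nx i : PAIdx k f) : ℤ) ≠ i := fun h => hM.nx_ne i (Subtype.ext h)
  split_ifs with h
  · rw [← Subtype.coe_lt_coe] at h
    rw [Int.emod_eq_of_lt (by omega) (by omega)]
    exact ⟨((nx i : PAIdx k f) - i - 1 : ℤ).toNat, by omega, by omega⟩
  · rw [← Subtype.coe_lt_coe] at h
    rw [← Int.add_emod_right, Int.emod_eq_of_lt (by omega) (by omega)]
    exact ⟨((nx i : PAIdx k f) - i + k - 1 : ℤ).toNat, by omega, by omega⟩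

lemma turn_horizPath (hW : IsClosedWalk k f) (hM : IsPairing A M) (i : PAIdx k f) :
    ∃ w Q, horizPath (f i) (f (M i)) = f i :: w :: Q ∧
      turn (f (i - 1)) (f i) w = 1 ∧ turn w (f i) (f (i + 1)) = 1 ∧ walkTurn f i = -1 := by
  obtain ⟨w, Q, h, hw⟩ := horizPath_eq_cons (hM.height_eq i) (hM.vertex_ne i)
  obtain ⟨h1, h2⟩ := hM.avoids i w (by simp [h])
  have ha : bwAdj (f i) (f (i - 1)) := bwAdj_comm (by simpa using hW.2.2.1 (i - 1))
  exact ⟨w, Q, h, turn_of_leftTurn ha i.2.2.2.1 hw h1 h2⟩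

lemma walkTurn_eq (hW : IsClosedWalk k f) (hM : IsPairing A M) (i : PAIdx k f) :
    walkTurn f i = -1 := by
  obtain ⟨_, _, _, _, _, h⟩ := hM.turn_horizPath hW i
  exact h

/-- The turns of an elementary cycle along one of its segments. -/
lemma segment_spec (hW : IsClosedWalk k f) (hM : IsPairing A M) (i : PAIdx k f) :
    (∃ R, (subwalkList k f i (nx i : PAIdx k f)).dropLast ++
      (horizPath (f (nx i : PAIdx k f)) (f (M (nx i)))).dropLast = f i :: f (i + 1) :: R) ∧
    listTurn ((subwalkList k f i (nx i : PAIdx k f)).dropLast ++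
      (horizPath (f (nx i : PAIdx k f)) (f (M (nx i)))).dropLast ++
        [f (M (nx i)), f (M (nx i) + 1)]) = segmentTurn M i := by
  obtain ⟨e, he, hie⟩ := hM.exists_gap i
  obtain ⟨w, Q, hwQ, hw, -, -⟩ := hM.turn_horizPath hW (nx i)
  obtain ⟨w', Q', hwQ', -, hw', -⟩ := hM.turn_horizPath hW (M (nx i))
  rw [hM.involutive (nx i)] at hwQ'
  have hrev := horizPath_reverse (hM.height_eq (nx i)).symm
  rw [hwQ'] at hrev
  have hper : f (i + e + 1) = f (nx i : PAIdx k f) ∧ f (i + e) = f ((nx i : PAIdx k f) - 1) := by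
    rw [hie, show (i : ℤ) + e = (i + e + 1) - 1 by ring, hie]
    split_ifs
    · exact ⟨rfl, rfl⟩
    · refine ⟨hW.2.1 _, ?_⟩
      rw [← hW.2.1 ((nx i : PAIdx k f) - 1)]
      congr 1
      ring
  have hsub : subwalkList k f i (nx i : PAIdx k f) =
      ((List.range e).map fun t : ℕ => f (i + (t : ℤ))) ++
        [f ((nx i : PAIdx k f) - 1), f (nx i : PAIdx k f)] := by
    rw [subwalkList_eq, he, List.range_succ, List.range_succ, ← hper.1, ← hper.2]
    simp [add_assoc]
  have hdrop : (subwalkList k f i (nx i : PAIdx k f)).dropLast =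
      ((List.range e).map fun t : ℕ => f (i + (t : ℤ))) ++ [f ((nx i : PAIdx k f) - 1)] := by
    rw [hsub]
    simp
  constructor
  · rw [hdrop, hwQ]
    match e, hper with
    | 0, hper =>
      refine ⟨(w :: Q).dropLast, ?_⟩
      rw [← hper.1, ← hper.2]
      simp
    | 1, hper =>
      rw [← hper.2]
      simp
    | e + 2, hper =>
      rw [List.range_succ_eq_map, List.range_succ_eq_map]
      simp
  · have hlast : (horizPath (f (nx i : PAIdx k f)) (f (M (nx i)))).dropLast ++
        [f (M (nx i)), f (M (nx i) + 1)] =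
        (f (nx i : PAIdx k f) :: w :: Q) ++ [f (M (nx i) + 1)] := by
      rw [← hwQ, hrev]
      simp
    have hjoin := listTurn_join ((List.range e).map fun t : ℕ => f (i + (t : ℤ))) Q Q'.reverse
      (f ((nx i : PAIdx k f) - 1)) (f (nx i : PAIdx k f)) w w' (f (M (nx i)))
      (f (M (nx i) + 1)) (by rw [← hwQ, hrev]; simp)
    rw [hdrop, List.append_assoc, hlast, ← List.append_assoc, hjoin, segmentTurn, hsub, hwQ,
      hw, hw']
    ring

lemma turningNumber_elemCycle (hW : IsClosedWalk k f) (hM : IsPairing A M)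
    (E : ElemCycle k f A) :
    turningNumber (ecLen E) (ecFun E) =
      ((∑ t ∈ Finset.range (Function.minimalPeriod (M ∘ nx) E.start),
        segmentTurn M ((M ∘ nx)^[t] E.start) : ℤ) : ℚ) / 6 := by
  have hidx (t : ℕ) (ht : t ≤ E.l + 1) : E.idx t = ((M ∘ nx)^[t] E.start : PAIdx k f) := by
    rcases Nat.lt_succ_iff_lt_or_eq.1 (Nat.lt_succ_of_le ht) with h | rfl
    · exact hM.idx_eq E (by omega)
    · rw [hM.iterate_start, E.canon _ (by omega)]
      rfl
  have hseg (t : ℕ) (ht : t < E.l + 1) : ecSegment E t =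
      (subwalkList k f ((M ∘ nx)^[t] E.start).1 (nx ((M ∘ nx)^[t] E.start)).1).dropLast ++
        (horizPath (f (nx ((M ∘ nx)^[t] E.start)).1)
          (f (M (nx ((M ∘ nx)^[t] E.start))).1)).dropLast := by
    have h1 : E.idx (if t = E.l then 0 else t + 1) = E.idx (t + 1) := by
      split_ifs with h
      · rw [E.canon (t + 1) (by omega)]
      · rfl
    rw [ecSegment, h1, hidx _ (by omega), hidx _ (by omega), Function.iterate_succ_apply']
    rfl
  choose R hR using fun i => (hM.segment_spec hW i).1
  have hS (t : ℕ) (ht : t < E.l + 1) : ecSegment E t = f ((M ∘ nx)^[t] E.start).1 ::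
      f (((M ∘ nx)^[t] E.start).1 + 1) :: R ((M ∘ nx)^[t] E.start) := by
    rw [hseg t ht, hR]
  have hsum := listTurn_flatMap (fun t => f ((M ∘ nx)^[t] E.start).1)
    (fun t => f (((M ∘ nx)^[t] E.start).1 + 1)) (ecSegment E)
    (fun t => R ((M ∘ nx)^[t] E.start)) (E.l + 1) hS
  have hopen : ∃ R', ecOpenList E = f E.start.1 :: f (E.start.1 + 1) :: R' := by
    rw [ecOpenList, List.range_succ_eq_map, List.flatMap_cons, hS 0 (by omega)]
    exact ⟨_, rfl⟩
  obtain ⟨R', hR'⟩ := hopen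
  rw [ecLen, ecFun, hR', turningNumber_listFun, ← hR', hM.minimalPeriod_start]
  simp only [hM.iterate_start] at hsum
  rw [ecOpenList, hsum]
  congr 2
  refine Finset.sum_congr rfl fun t ht => ?_
  rw [hseg t (Finset.mem_range.1 ht), Function.iterate_succ_apply']
  exact (hM.segment_spec hW _).2

/-! ### The total turn -/

lemma listTurn_subwalkList (hW : IsClosedWalk k f) (hM : IsPairing A M) (i : PAIdx k f) :
    listTurn (subwalkList k f i (nx i : PAIdx k f)) =
      partialTurn f (nx i).1.toNat - partialTurn f i.1.toNat +
        (if i < nx i then 0 else partialTurn f k) + 1 := by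
  obtain ⟨e, he, hie⟩ := hM.exists_gap i
  have hi : ((i.1.toNat : ℕ) : ℤ) = i := Int.toNat_of_nonneg i.2.1
  have hj : (((nx i).1.toNat : ℕ) : ℤ) = (nx i).1 := Int.toNat_of_nonneg (nx i).2.1
  have h1 : partialTurn f (i.1.toNat + (e + 1)) = partialTurn f i.1.toNat +
      (listTurn (subwalkList k f i (nx i : PAIdx k f)) - 1) := by
    rw [partialTurn, Finset.sum_range_add, Finset.sum_range_succ', subwalkList_eq, he,
      listTurn_map_range]
    push_cast
    rw [hi, add_zero, hM.walkTurn_eq hW i]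
    have : ∑ x ∈ Finset.range e, walkTurn f (i.1 + ((x : ℤ) + 1)) =
        ∑ r ∈ Finset.range e, turn (f (i.1 + (r : ℤ))) (f (i.1 + ((r : ℤ) + 1)))
          (f (i.1 + ((r : ℤ) + 2))) := by
      refine Finset.sum_congr rfl fun r _ => ?_
      rw [walkTurn]
      congr 2
      all_goals ring
    rw [this]
    rfl
  split_ifs at hie ⊢ with h
  · have : i.1.toNat + (e + 1) = (nx i).1.toNat := by omega
    rw [this] at h1
    linarith
  · have : i.1.toNat + (e + 1) = k + (nx i).1.toNat := by omega
    rw [this, partialTurn_add_period hW] at h1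
    linarith

lemma sum_segmentTurn (hW : IsClosedWalk k f) (hM : IsPairing A M) [Nonempty (PAIdx k f)] :
    ∑ i, segmentTurn M i = partialTurn f k + 3 * Fintype.card (PAIdx k f) := by
  have hbij : Function.Bijective (nx : PAIdx k f → PAIdx k f) :=
    Finite.injective_iff_bijective.1 nx_injective
  have hhoriz : ∑ i : PAIdx k f, listTurn (horizPath (f (nx i).1) (f (M (nx i)).1)) = 0 := by
    rw [hbij.sum_comp fun i : PAIdx k f => listTurn (horizPath (f i.1) (f (M i).1))]
    have h1 := hM.involutive.bijective.sum_comp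
      fun i : PAIdx k f => listTurn (horizPath (f i.1) (f (M i).1))
    have h2 : ∀ i : PAIdx k f, listTurn (horizPath (f (M i).1) (f (M (M i)).1)) =
        -listTurn (horizPath (f i.1) (f (M i).1)) := by
      intro i
      rw [hM.involutive, horizPath_reverse (hM.height_eq i), listTurn_reverse]
    simp only [h2, Finset.sum_neg_distrib] at h1
    linarith
  have htel := hbij.sum_comp fun i : PAIdx k f => partialTurn f i.1.toNat
  obtain ⟨m, hm⟩ : ∃ m : PAIdx k f, ∀ x, x ≤ m := Finite.exists_max id
  have htop : ∑ i : PAIdx k f, (if i < nx i then 0 else partialTurn f k) = partialTurn f k := by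
    rw [Finset.sum_eq_single m]
    · rw [if_neg (hm _).not_gt]
    · intro i _ hi
      exact if_pos (nx_of_lt i m (lt_of_le_of_ne (hm i) hi)).1
    · exact fun h => absurd (Finset.mem_univ m) h
  simp only [segmentTurn, hM.listTurn_subwalkList hW, Finset.sum_add_distrib,
    Finset.sum_sub_distrib, htel, htop, hhoriz, Finset.sum_const, Finset.card_univ]
  simp
  ring

end IsPairing

lemma turningNumber_eq_partialTurn (k : ℕ) (f : ℤ → ℤ × ℤ) :
    turningNumber k f = (partialTurn f k : ℚ) / 6 :=
  turningNumber_eq_sum k f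

/-- Let `A` be a proper assignment set for a closed walk `W` in the
brickwall and `𝒞` the set of elementary cycles of `(W, A)`.
Then `t(W) = Σ_{C ∈ 𝒞} (t(C) − 1) + 1`. -/
theorem turningNumber_eq_elemTurnSum
    (k : ℕ) (f : ℤ → ℤ × ℤ) (A : Set (Finset ℤ))
    (hW : IsClosedWalk k f) (hA : IsProperAssignment k f A) :
    turningNumber k f = elemTurnSum k f A + 1 := by
  by_cases h : A = ∅ ∧ ∀ i : ℤ, ¬ IsPAIndex k f i
  · rw [elemTurnSum, if_pos h]
    ring
  · rw [elemTurnSum, if_neg h]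
    obtain ⟨M, hM⟩ := exists_isPairing hA
    have hne : Nonempty (PAIdx k f) := by
      by_contra hemp
      rw [not_nonempty_iff] at hemp
      have hno (i : ℤ) : ¬ IsPAIndex k f i := fun hi => hemp.false ⟨i, hi⟩
      refine h ⟨Set.eq_empty_of_forall_notMem fun p hp => ?_, hno⟩
      obtain ⟨x, _, _, hx, _⟩ := hA.1 p hp
      exact hno x hx
    obtain ⟨b, hb⟩ := Finite.exists_min (id : PAIdx k f → PAIdx k f)
    have hcard := card_orbitMins_of_noncrossing hM.involutive hM.ne hM.noncrossing
      nx_injective nx_of_lt nx_of_top hb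
    have hsum := (sum_orbitMins hM.comp_injective (segmentTurn M)).trans (hM.sum_segmentTurn hW)
    let g : PAIdx k f → ℚ := fun m =>
      ((∑ t ∈ Finset.range (Function.minimalPeriod (M ∘ nx) m),
        segmentTurn M ((M ∘ nx)^[t] m) : ℤ) : ℚ) / 6 - 1
    have hfin : ∑ᶠ E : ElemCycle k f A, (turningNumber (ecLen E) (ecFun E) - 1) =
        ∑ m ∈ orbitMins (M ∘ nx), g m := by
      rw [← finsum_mem_coe_finset, ← hM.range_start, finsum_mem_range hM.start_injective]
      exact finsum_congr fun E => by rw [hM.turningNumber_elemCycle hW E]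
    have hcardQ : 2 * ((orbitMins (M ∘ nx)).card : ℚ) = Fintype.card (PAIdx k f) + 2 := by
      exact_mod_cast hcard
    have hsumQ := congrArg (Int.cast : ℤ → ℚ) hsum
    push_cast at hsumQ
    rw [hfin, turningNumber_eq_partialTurn]
    simp only [g, Finset.sum_sub_distrib, ← Finset.sum_div, Finset.sum_const, nsmul_eq_mul,
      mul_one]
    push_cast
    rw [hsumQ]
    linarith

end Hex
end

section
/- Let S be a nonempty finite set of natural numbers and let M be a partition of S into pairs such that no two pairs {i,j} and {x,y} in M satisfy i < x < j < y. Then there is a pair {x,y} ∈ M with x < y such that no element of S lies strictly between x and y. -/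
/-- Let `S` be a nonempty finite set of natural numbers and `M` a
non-crossing partition of `S` into pairs. Then some pair `{x,y} ∈ M` with `x < y` has
no element of `S` strictly between `x` and `y`. -/
theorem noncrossing_perfect_matching_has_short_pair
    (S : Finset ℕ) (hS : S.Nonempty) (M : Set (Finset ℕ))
    (hpairs : ∀ p ∈ M, ∃ x y : ℕ, x ∈ S ∧ y ∈ S ∧ x ≠ y ∧ p = {x, y})
    (hpart : ∀ a ∈ S, ∃! p, p ∈ M ∧ a ∈ p)
    (hnc : ∀ p ∈ M, ∀ q ∈ M, ∀ i ∈ p, ∀ j ∈ p, ∀ x ∈ q, ∀ y ∈ q,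
      ¬(i < x ∧ x < j ∧ j < y)) :
    ∃ p ∈ M, ∃ x y : ℕ, p = {x, y} ∧ x < y ∧ ∀ a ∈ S, ¬(x < a ∧ a < y) := by
  have partner : ∀ a ∈ S, ∃ b, b ≠ a ∧ ({a, b} : Finset ℕ) ∈ M := by
    intro a ha
    obtain ⟨p, ⟨hp, hap⟩, -⟩ := hpart a ha
    obtain ⟨x, y, -, -, hxy, rfl⟩ := hpairs p hp
    rcases Finset.mem_insert.mp hap with rfl | hay
    · exact ⟨y, hxy.symm, hp⟩
    · obtain rfl := Finset.mem_singleton.mp hay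
      exact ⟨x, hxy, Finset.pair_comm x a ▸ hp⟩
  have descend : ∀ d x y : ℕ, y - x = d → x < y → ({x, y} : Finset ℕ) ∈ M →
      ∃ p ∈ M, ∃ x y : ℕ, p = {x, y} ∧ x < y ∧ ∀ a ∈ S, ¬(x < a ∧ a < y) := by
    intro d
    induction d using Nat.strong_induction_on with
    | _ d ih =>
      intro x y hd hxy hp
      by_cases hshort : ∀ a ∈ S, ¬(x < a ∧ a < y)
      · exact ⟨_, hp, x, y, rfl, hxy, hshort⟩
      push Not at hshort
      obtain ⟨a, ha, hxa, hay⟩ := hshort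
      obtain ⟨b, hba, hq⟩ := partner a ha
      have hb : b ∈ S := by
        obtain ⟨u, v, hu, hv, -, huv⟩ := hpairs _ hq
        have hmem : b ∈ ({u, v} : Finset ℕ) := huv ▸ by simp
        rcases Finset.mem_insert.mp hmem with rfl | h
        · exact hu
        · exact Finset.mem_singleton.mp h ▸ hv
      have hbp : b ∉ ({x, y} : Finset ℕ) := by
        intro h
        have heq := (hpart b hb).unique ⟨hp, h⟩ ⟨hq, by simp⟩
        have hap : a ∈ ({x, y} : Finset ℕ) := heq ▸ by simp
        simp only [Finset.mem_insert, Finset.mem_singleton] at hap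
        omega
      have hright := hnc _ hp _ hq x (by simp) y (by simp) a (by simp) b (by simp)
      have hleft := hnc _ hq _ hp b (by simp) a (by simp) x (by simp) y (by simp)
      simp only [Finset.mem_insert, Finset.mem_singleton] at hbp
      rcases lt_or_gt_of_ne hba with h | h
      · exact ih (a - b) (by omega) b a rfl h (Finset.pair_comm a b ▸ hq)
      · exact ih (b - a) (by omega) a b rfl h hq
  obtain ⟨a, ha⟩ := hS
  obtain ⟨b, hba, hp⟩ := partner a ha
  rcases lt_or_gt_of_ne hba with h | h
  · exact descend _ b a rfl h (Finset.pair_comm a b ▸ hp)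
  · exact descend _ a b rfl h hp
end

section
/- Let G be a graph with vertex set {0,…,n−1} and positive edge weights w, and let 0 ≤ i < j ≤ n−1. Then S_{i,j} equals the maximum of the following quantities: S_{i+1,j}; the values S_{i,v} + S_{v+1,j} over all neighbors v of i with i+1 ≤ v ≤ j−1; and, in case {i,j} is an edge of G, the value w_{ij} + S_{i+1,j−1}. -/
open scoped Classical

namespace PlanarMatching

/-- `M` is a planar matching of the induced subgraph `G_{i,j}` of the graph with
adjacency relation `Adj`: edges are recorded as ordered pairs `(a,b)` with `a < b`,
both endpoints lie in `{i,…,j}`, no two edges share an endpoint, and no two edges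
`{a,b}`, `{x,y}` satisfy `a < x < b < y`. -/
def IsPM (Adj : ℕ → ℕ → Prop) (i j : ℕ) (M : Finset (ℕ × ℕ)) : Prop :=
  (∀ e ∈ M, e.1 < e.2 ∧ Adj e.1 e.2 ∧ i ≤ e.1 ∧ e.2 ≤ j) ∧
  (∀ e ∈ M, ∀ e' ∈ M, e ≠ e' →
    e.1 ≠ e'.1 ∧ e.1 ≠ e'.2 ∧ e.2 ≠ e'.1 ∧ e.2 ≠ e'.2) ∧
  (∀ e ∈ M, ∀ e' ∈ M, ¬(e.1 < e'.1 ∧ e'.1 < e.2 ∧ e.2 < e'.2))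

/-- The total weight `Σ_{e ∈ M} w_e` of a matching. -/
def wt (w : ℕ → ℕ → ℝ) (M : Finset (ℕ × ℕ)) : ℝ := ∑ e ∈ M, w e.1 e.2

/-- `S_{i,j}`: the maximum total weight of a planar matching of `G_{i,j}`. -/
noncomputable def Sval (Adj : ℕ → ℕ → Prop) (w : ℕ → ℕ → ℝ) (i j : ℕ) : ℝ :=
  sSup {x : ℝ | ∃ M : Finset (ℕ × ℕ), IsPM Adj i j M ∧ wt w M = x}

/-- `N_{i,j}`: the number of planar matchings of `G_{i,j}` of total weight `S_{i,j}`. -/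
noncomputable def Nval (Adj : ℕ → ℕ → Prop) (w : ℕ → ℕ → ℝ) (i j : ℕ) : ℕ :=
  Nat.card {M : Finset (ℕ × ℕ) // IsPM Adj i j M ∧ wt w M = Sval Adj w i j}

section

variable {Adj : ℕ → ℕ → Prop} {w : ℕ → ℕ → ℝ} {i j v : ℕ} {M M₁ M₂ : Finset (ℕ × ℕ)}

theorem isPM_empty : IsPM Adj i j ∅ := by
  simp [IsPM]

theorem finite_setOf_isPM (Adj : ℕ → ℕ → Prop) (i j : ℕ) : {M | IsPM Adj i j M}.Finite := by
  refine (Finset.finite_toSet (Finset.range (j + 1) ×ˢ Finset.range (j + 1)).powerset).subset ?_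
  intro M hM
  simp only [Finset.mem_coe, Finset.mem_powerset]
  intro e he
  have := hM.1 e he
  simp only [Finset.mem_product, Finset.mem_range]
  omega

theorem finite_setOf_wt (Adj : ℕ → ℕ → Prop) (w : ℕ → ℕ → ℝ) (i j : ℕ) :
    {x : ℝ | ∃ M : Finset (ℕ × ℕ), IsPM Adj i j M ∧ wt w M = x}.Finite :=
  (finite_setOf_isPM Adj i j).image (wt w)

theorem IsPM.wt_le_Sval (hM : IsPM Adj i j M) : wt w M ≤ Sval Adj w i j :=
  le_csSup (finite_setOf_wt Adj w i j).bddAbove ⟨M, hM, rfl⟩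

theorem exists_isPM_wt_eq_Sval (Adj : ℕ → ℕ → Prop) (w : ℕ → ℕ → ℝ) (i j : ℕ) :
    ∃ M, IsPM Adj i j M ∧ wt w M = Sval Adj w i j :=
  Set.Nonempty.csSup_mem (s := {x : ℝ | ∃ M, IsPM Adj i j M ∧ wt w M = x})
    ⟨_, ∅, isPM_empty, rfl⟩ (finite_setOf_wt Adj w i j)

theorem IsPM.subset (hM : IsPM Adj i j M) {i' j' : ℕ} (hsub : M₁ ⊆ M)
    (hrange : ∀ e ∈ M₁, i' ≤ e.1 ∧ e.2 ≤ j') : IsPM Adj i' j' M₁ :=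
  ⟨fun e he => ⟨(hM.1 e (hsub he)).1, (hM.1 e (hsub he)).2.1, hrange e he⟩,
    fun e he e' he' => hM.2.1 e (hsub he) e' (hsub he'),
    fun e he e' he' => hM.2.2 e (hsub he) e' (hsub he')⟩

theorem IsPM.union (h₁ : IsPM Adj i v M₁) (h₂ : IsPM Adj (v + 1) j M₂) (hiv : i ≤ v)
    (hvj : v ≤ j) : IsPM Adj i j (M₁ ∪ M₂) := by
  refine ⟨fun e he => ?_, fun e he e' he' hne => ?_, fun e he e' he' => ?_⟩
  · rcases Finset.mem_union.1 he with he | he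
    · have := h₁.1 e he
      exact ⟨this.1, this.2.1, by omega, by omega⟩
    · have := h₂.1 e he
      exact ⟨this.1, this.2.1, by omega, by omega⟩
  · rcases Finset.mem_union.1 he with he | he <;> rcases Finset.mem_union.1 he' with he' | he'
    · exact h₁.2.1 e he e' he' hne
    · have := h₁.1 e he
      have := h₂.1 e' he'
      omega
    · have := h₂.1 e he
      have := h₁.1 e' he'
      omega
    · exact h₂.2.1 e he e' he' hne
  · rcases Finset.mem_union.1 he with he | he <;> rcases Finset.mem_union.1 he' with he' | he'
    · exact h₁.2.2 e he e' he'
    · have := h₁.1 e he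
      have := h₂.1 e' he'
      omega
    · have := h₂.1 e he
      have := h₁.1 e' he'
      omega
    · exact h₂.2.2 e he e' he'

theorem IsPM.insert_outer (hM : IsPM Adj (i + 1) (j - 1) M) (hij : i < j) (hadj : Adj i j) :
    IsPM Adj i j (insert (i, j) M) := by
  refine ⟨fun e he => ?_, fun e he e' he' hne => ?_, fun e he e' he' => ?_⟩
  · rcases Finset.mem_insert.1 he with rfl | he
    · exact ⟨hij, hadj, le_rfl, le_rfl⟩
    · have := hM.1 e he
      exact ⟨this.1, this.2.1, by omega, by omega⟩
  · rcases Finset.mem_insert.1 he with rfl | he <;> rcases Finset.mem_insert.1 he' with rfl | he'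
    · exact absurd rfl hne
    · have := hM.1 e' he'
      dsimp only
      omega
    · have := hM.1 e he
      dsimp only
      omega
    · exact hM.2.1 e he e' he' hne
  · rcases Finset.mem_insert.1 he with rfl | he <;> rcases Finset.mem_insert.1 he' with rfl | he'
    · dsimp only
      omega
    · have := hM.1 e' he'
      dsimp only
      omega
    · have := hM.1 e he
      dsimp only
      omega
    · exact hM.2.2 e he e' he'

theorem Sval_succ_le : Sval Adj w (i + 1) j ≤ Sval Adj w i j := by
  obtain ⟨M, hM, hw⟩ := exists_isPM_wt_eq_Sval Adj w (i + 1) j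
  rw [← hw]
  refine (hM.subset subset_rfl fun e he => ?_).wt_le_Sval
  have := hM.1 e he
  omega

theorem Sval_add_Sval_le (hiv : i ≤ v) (hvj : v ≤ j) :
    Sval Adj w i v + Sval Adj w (v + 1) j ≤ Sval Adj w i j := by
  obtain ⟨M₁, h₁, hw₁⟩ := exists_isPM_wt_eq_Sval Adj w i v
  obtain ⟨M₂, h₂, hw₂⟩ := exists_isPM_wt_eq_Sval Adj w (v + 1) j
  have hdisj : Disjoint M₁ M₂ := Finset.disjoint_left.2 fun e he₁ he₂ => by
    have := h₁.1 e he₁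
    have := h₂.1 e he₂
    omega
  have hle := (h₁.union h₂ hiv hvj).wt_le_Sval (w := w)
  rwa [wt, Finset.sum_union hdisj, ← wt, ← wt, hw₁, hw₂] at hle

theorem weight_add_Sval_le (hij : i < j) (hadj : Adj i j) :
    w i j + Sval Adj w (i + 1) (j - 1) ≤ Sval Adj w i j := by
  obtain ⟨M, hM, hw⟩ := exists_isPM_wt_eq_Sval Adj w (i + 1) (j - 1)
  have hnot : (i, j) ∉ M := fun h => by
    have := hM.1 _ h
    dsimp only at this
    omega
  have hle := (hM.insert_outer hij hadj).wt_le_Sval (w := w)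
  rwa [wt, Finset.sum_insert hnot, ← wt, hw] at hle

theorem IsPM.wt_le_Sval_succ (hM : IsPM Adj i j M) (hi : ∀ v, (i, v) ∉ M) :
    wt w M ≤ Sval Adj w (i + 1) j := by
  refine (hM.subset subset_rfl fun e he => ?_).wt_le_Sval
  have hne : e.1 ≠ i := fun h => hi e.2 (by rwa [← h])
  have := hM.1 e he
  omega

theorem IsPM.wt_le_Sval_add_Sval (hM : IsPM Adj i j M) (hv : (i, v) ∈ M) :
    wt w M ≤ Sval Adj w i v + Sval Adj w (v + 1) j := by
  have hleft : IsPM Adj i v (M.filter fun e => e.2 ≤ v) :=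
    hM.subset (Finset.filter_subset _ _) fun e he =>
      ⟨(hM.1 e (Finset.mem_filter.1 he).1).2.2.1, (Finset.mem_filter.1 he).2⟩
  have hright : IsPM Adj (v + 1) j (M.filter fun e => ¬ e.2 ≤ v) := by
    refine hM.subset (Finset.filter_subset _ _) fun e he => ?_
    obtain ⟨he, hev⟩ := Finset.mem_filter.1 he
    have hne : (i, v) ≠ e := by
      rintro rfl
      exact hev le_rfl
    have hend := hM.2.1 _ hv e he hne
    have hcross := hM.2.2 _ hv e he
    have hrange := hM.1 e he
    dsimp only at hend hcross
    omega
  calc wt w M = wt w (M.filter fun e => e.2 ≤ v) + wt w (M.filter fun e => ¬ e.2 ≤ v) :=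
        (Finset.sum_filter_add_sum_filter_not M _ _).symm
    _ ≤ _ := add_le_add hleft.wt_le_Sval hright.wt_le_Sval

theorem IsPM.wt_le_weight_add_Sval (hM : IsPM Adj i j M) (hmem : (i, j) ∈ M) :
    wt w M ≤ w i j + Sval Adj w (i + 1) (j - 1) := by
  have hinner : IsPM Adj (i + 1) (j - 1) (M.erase (i, j)) := by
    refine hM.subset (Finset.erase_subset _ _) fun e he => ?_
    obtain ⟨hne, he⟩ := Finset.mem_erase.1 he
    have hend := hM.2.1 _ hmem e he hne.symm
    have hrange := hM.1 e he
    dsimp only at hend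
    omega
  calc wt w M = w i j + wt w (M.erase (i, j)) :=
        (Finset.add_sum_erase M (fun e => w e.1 e.2) hmem).symm
    _ ≤ _ := by gcongr; exact hinner.wt_le_Sval

end

/-- For a graph on `{0,…,n-1}` with positive edge weights and
`0 ≤ i < j ≤ n-1`, `S_{i,j}` is the maximum of: `S_{i+1,j}`; the values
`S_{i,v} + S_{v+1,j}` over neighbors `v` of `i` with `i+1 ≤ v ≤ j-1`; and, if `{i,j}`
is an edge, `w_{ij} + S_{i+1,j-1}`. -/
theorem Sval_recurrence
    (n : ℕ) (Adj : ℕ → ℕ → Prop) (w : ℕ → ℕ → ℝ)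
    (hsymm : ∀ a b, Adj a b → Adj b a)
    (hsupp : ∀ a b, Adj a b → a < n ∧ b < n ∧ a ≠ b)
    (hwsymm : ∀ a b, w a b = w b a)
    (hwpos : ∀ a b, Adj a b → 0 < w a b)
    (i j : ℕ) (hij : i < j) (hjn : j ≤ n - 1) :
    Sval Adj w i j = sSup
      (({Sval Adj w (i + 1) j} : Set ℝ) ∪
       {x : ℝ | ∃ v : ℕ, Adj i v ∧ i + 1 ≤ v ∧ v ≤ j - 1 ∧
         x = Sval Adj w i v + Sval Adj w (v + 1) j} ∪
       {x : ℝ | Adj i j ∧ x = w i j + Sval Adj w (i + 1) (j - 1)}) := by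
  refine (IsGreatest.csSup_eq ⟨?_, ?_⟩).symm
  · obtain ⟨M, hM, hw⟩ := exists_isPM_wt_eq_Sval Adj w i j
    by_cases hi : ∃ v, (i, v) ∈ M
    · obtain ⟨v, hv⟩ := hi
      obtain ⟨hiv, hadj, -, hvj⟩ := hM.1 _ hv
      dsimp only at hiv hadj hvj
      rcases hvj.eq_or_lt with rfl | hlt
      · exact Or.inr ⟨hadj, le_antisymm (hw ▸ hM.wt_le_weight_add_Sval hv)
          (weight_add_Sval_le hij hadj)⟩
      · exact Or.inl (Or.inr ⟨v, hadj, hiv, by omega,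
          le_antisymm (hw ▸ hM.wt_le_Sval_add_Sval hv) (Sval_add_Sval_le hiv.le hvj)⟩)
    · push Not at hi
      exact Or.inl (Or.inl (le_antisymm (hw ▸ hM.wt_le_Sval_succ hi) Sval_succ_le))
  · rintro x ((rfl | ⟨v, -, hiv, hvj, rfl⟩) | ⟨hadj, rfl⟩)
    · exact Sval_succ_le
    · exact Sval_add_Sval_le (by omega) (by omega)
    · exact weight_add_Sval_le hij hadj

end PlanarMatching
end
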